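/- If f, g ∈ L¹(ℝ) both vanish on (-∞, 0), and the convolution f * g vanishes almost everywhere on (-∞, T], then there exist real numbers α, β ≥ 0 with α + β = T such that f vanishes almost everywhere on [0, α] and g vanishes almost everywhere on [0, β]. -/

import Mathlib

open MeasureTheory

namespace Titch

lemma blaschke_id (ρ : ℝ) (a z : ℂ) :
    ‖(ρ:ℂ)^2 - (starRingEnd ℂ) a * z‖^2 - ρ^2 * ‖z - a‖^2 = (ρ^2 - ‖a‖^2) * (ρ^2 - ‖z‖^2) := by
  simp only [← Complex.normSq_eq_norm_sq, Complex.normSq_apply]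
  simp [pow_two]
  ring

lemma factor_zero (F : ℂ → ℂ) (hF : Differentiable ℂ F) (w a : ℂ) (hw : F w ≠ 0) :
    ∃ (n : ℕ) (G : ℂ → ℂ), Differentiable ℂ G ∧ G a ≠ 0 ∧ ∀ z, F z = (z - a)^n * G z := by
  have han : AnalyticAt ℂ F a := hF.analyticAt a
  have hne : ¬ ∀ᶠ z in nhds a, F z = 0 := by
    intro h
    have := (hF.differentiableOn.analyticOnNhd isOpen_univ).eq_of_eventuallyEq
      (g := 0) (analyticOnNhd_const) (z₀ := a) h
    exact hw (by rw [this]; rfl)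
  obtain ⟨n, g, hg, hga, hev⟩ := (han.exists_eventuallyEq_pow_smul_nonzero_iff).2 hne
  let G : ℂ → ℂ := fun z => if z = a then g a else F z / (z - a)^n
  have hGg : G =ᶠ[nhds a] g := by
    filter_upwards [hev] with z hz
    by_cases h : z = a
    · simp [G, h]
    · have : (z - a)^n ≠ 0 := pow_ne_zero _ (sub_ne_zero.2 h)
      simp only [G, h, if_false, hz, smul_eq_mul]
      field_simp
  refine ⟨n, G, ?_, by simpa [G] using hga, ?_⟩
  · intro z
    by_cases h : z = a
    · subst h
      exact hg.differentiableAt.congr_of_eventuallyEq hGg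
    · have h1 : G =ᶠ[nhds z] fun z => F z / (z - a)^n := by
        filter_upwards [isOpen_ne.mem_nhds h] with y hy
        have : y ≠ a := hy
        simp [G, this]
      refine DifferentiableAt.congr_of_eventuallyEq ?_ h1
      exact (hF z).div (by fun_prop) (pow_ne_zero _ (sub_ne_zero.2 h))
  · intro z
    by_cases h : z = a
    · subst h
      have := hev.self_of_nhds
      simpa [G] using this
    · have : (z - a)^n ≠ 0 := pow_ne_zero _ (sub_ne_zero.2 h)
      simp only [G, h, if_false]
      field_simp

lemma zeros_finite (F : ℂ → ℂ) (hF : Differentiable ℂ F) (w : ℂ) (hw : F w ≠ 0)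
    (c : ℂ) (ρ : ℝ) : {z | z ∈ Metric.closedBall c ρ ∧ F z = 0}.Finite := by
  by_contra hinf
  obtain ⟨a, ha, hacc⟩ := Set.Infinite.exists_accPt_of_subset_isCompact (s := {z | z ∈ Metric.closedBall c ρ ∧ F z = 0}) hinf
    (isCompact_closedBall c ρ) (fun z hz => hz.1)
  have := (hF.differentiableOn.analyticOnNhd isOpen_univ).eqOn_zero_of_preconnected_of_frequently_eq_zero
    isPreconnected_univ (Set.mem_univ a) ?_
  · exact hw (this (Set.mem_univ w))
  · rw [accPt_iff_frequently_nhdsNE] at hacc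
    exact hacc.mono fun z hz => hz.2

lemma blaschke_ne (c a : ℂ) (ρ : ℝ) (hρ : 0 < ρ) (ha : a ∈ Metric.ball c ρ) (z : ℂ)
    (hz : z ∈ Metric.closedBall c ρ) :
    ((ρ:ℂ)^2 - (starRingEnd ℂ) (a - c) * (z - c)) / ρ ≠ 0 := by
  rw [mem_ball_iff_norm] at ha
  rw [mem_closedBall_iff_norm] at hz
  intro h
  have hρ' : (ρ:ℂ) ≠ 0 := by exact_mod_cast hρ.ne'
  rw [div_eq_zero_iff, or_iff_left hρ', sub_eq_zero] at h
  have h2 := congrArg norm h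
  rw [norm_mul, norm_pow, Complex.norm_real, RCLike.norm_conj, Real.norm_of_nonneg hρ.le] at h2
  nlinarith [norm_nonneg (a - c), norm_nonneg (z - c)]

lemma blaschke_le (c a : ℂ) (ρ : ℝ) (hρ : 0 < ρ) (ha : a ∈ Metric.ball c ρ) (z : ℂ)
    (hz : z ∈ Metric.closedBall c ρ) :
    ‖z - a‖ ≤ ‖((ρ:ℂ)^2 - (starRingEnd ℂ) (a - c) * (z - c)) / ρ‖ := by
  rw [mem_ball_iff_norm] at ha
  rw [mem_closedBall_iff_norm] at hz
  have h := blaschke_id ρ (a - c) (z - c)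
  rw [show z - c - (a - c) = z - a by ring] at h
  rw [norm_div, Complex.norm_real, Real.norm_of_nonneg hρ.le, le_div_iff₀ hρ]
  have h1 : 0 ≤ ρ^2 - ‖a - c‖^2 := by nlinarith [norm_nonneg (a - c)]
  have h2 : 0 ≤ ρ^2 - ‖z - c‖^2 := by nlinarith [norm_nonneg (z - c)]
  apply le_of_sq_le_sq _ (norm_nonneg _)
  nlinarith [mul_nonneg h1 h2]

lemma blaschke_eq (c a : ℂ) (ρ : ℝ) (hρ : 0 < ρ) (z : ℂ)
    (hz : z ∈ Metric.sphere c ρ) :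
    ‖((ρ:ℂ)^2 - (starRingEnd ℂ) (a - c) * (z - c)) / ρ‖ = ‖z - a‖ := by
  rw [mem_sphere_iff_norm] at hz
  have h := blaschke_id ρ (a - c) (z - c)
  rw [show z - c - (a - c) = z - a by ring, hz] at h
  rw [norm_div, Complex.norm_real, Real.norm_of_nonneg hρ.le, div_eq_iff hρ.ne']
  rw [← sq_eq_sq₀ (norm_nonneg _) (by positivity)]
  nlinarith

lemma remove_zeros (c w : ℂ) (ρ : ℝ) (hρ : 0 < ρ) (hwb : w ∈ Metric.closedBall c ρ) (n : ℕ) :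
    ∀ (F : ℂ → ℂ), Differentiable ℂ F →
    F w ≠ 0 → (∀ z ∈ Metric.sphere c ρ, F z ≠ 0) →
    {z | z ∈ Metric.closedBall c ρ ∧ F z = 0}.ncard = n →
    ∃ h : ℂ → ℂ, Differentiable ℂ h ∧ (∀ z ∈ Metric.closedBall c ρ, h z ≠ 0) ∧
      (∀ z ∈ Metric.closedBall c ρ, ‖F z‖ ≤ ‖h z‖) ∧ (∀ z ∈ Metric.sphere c ρ, ‖h z‖ = ‖F z‖) := by
  induction n with
  | zero =>
    intro F hF hw hs hn
    rw [Set.ncard_eq_zero (zeros_finite F hF w hw c ρ)] at hn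
    refine ⟨F, hF, fun z hz h0 => ?_, fun _ _ => le_rfl, fun _ _ => rfl⟩
    have : z ∈ {z | z ∈ Metric.closedBall c ρ ∧ F z = 0} := ⟨hz, h0⟩
    rw [hn] at this
    exact this
  | succ n ih =>
    intro F hF hw hs hn
    have hfin := zeros_finite F hF w hw c ρ
    obtain ⟨a, hac, ha0⟩ : {z | z ∈ Metric.closedBall c ρ ∧ F z = 0}.Nonempty := by
      rw [← Set.ncard_pos hfin]; omega
    have hab : a ∈ Metric.ball c ρ := by
      rcases (Metric.mem_closedBall.1 hac).lt_or_eq with h | h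
      · exact h
      · exact absurd ha0 (hs a h)
    obtain ⟨m, G, hG, hGa, hFG⟩ := factor_zero F hF w a hw
    have hm : m ≠ 0 := by
      rintro rfl
      rw [hFG a] at ha0
      simp at ha0
      exact hGa ha0
    let B : ℂ → ℂ := fun z => ((ρ:ℂ)^2 - (starRingEnd ℂ) (a - c) * (z - c)) / ρ
    let F' : ℂ → ℂ := fun z => (B z)^m * G z
    have hF' : Differentiable ℂ F' := by
      simp only [F', B]
      fun_prop
    have hle : ∀ z ∈ Metric.closedBall c ρ, ‖F z‖ ≤ ‖F' z‖ := by
      intro z hz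
      rw [hFG z, norm_mul, norm_mul, norm_pow, norm_pow]
      gcongr
      exact blaschke_le c a ρ hρ hab z hz
    have heq : ∀ z ∈ Metric.sphere c ρ, ‖F' z‖ = ‖F z‖ := by
      intro z hz
      rw [hFG z, norm_mul, norm_mul, norm_pow, norm_pow]
      congr 2
      exact blaschke_eq c a ρ hρ z hz
    have hset : {z | z ∈ Metric.closedBall c ρ ∧ F' z = 0} =
        {z | z ∈ Metric.closedBall c ρ ∧ F z = 0} \ {a} := by
      ext z
      simp only [Set.mem_ofPred_eq, Set.mem_sdiff, Set.mem_singleton_iff]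
      constructor
      · rintro ⟨hz, h0⟩
        have hB : (B z)^m ≠ 0 := pow_ne_zero _ (blaschke_ne c a ρ hρ hab z hz)
        have hG0 : G z = 0 := by simpa [F', hB] using h0
        refine ⟨⟨hz, by rw [hFG z, hG0, mul_zero]⟩, ?_⟩
        rintro rfl
        exact hGa hG0
      · rintro ⟨⟨hz, h0⟩, hza⟩
        refine ⟨hz, ?_⟩
        rw [hFG z] at h0
        have : G z = 0 := by
          rcases mul_eq_zero.1 h0 with h | h
          · exact absurd (sub_eq_zero.1 (pow_eq_zero_iff hm |>.1 h)) hza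
          · exact h
        simp [F', this]
    obtain ⟨h, h1, h2, h3, h4⟩ := ih F' hF'
      (norm_pos_iff.1 (lt_of_lt_of_le (norm_pos_iff.2 hw) (hle w hwb)))
      (fun z hz => norm_pos_iff.1 (by rw [heq z hz]; exact norm_pos_iff.2 (hs z hz)))
      (by rw [hset, Set.ncard_sdiff_singleton_of_mem (by exact ⟨hac, ha0⟩), hn]; rfl)
    exact ⟨h, h1, h2, fun z hz => (hle z hz).trans (h3 z hz),
      fun z hz => (h4 z hz).trans (heq z hz)⟩

lemma harnack (c w : ℂ) (ρ : ℝ) (hwb : w ∈ Metric.ball c ρ)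
    (F : ℂ → ℂ) (hF : Differentiable ℂ F) (hw : F w ≠ 0) (hs : ∀ z ∈ Metric.sphere c ρ, F z ≠ 0)
    (h1 : ∀ z ∈ Metric.sphere c ρ, ‖F z‖ ≤ 1) :
    (ρ - ‖w - c‖) / (ρ + ‖w - c‖) * Real.circleAverage (fun z => - Real.log ‖F z‖) c ρ
      ≤ - Real.log ‖F w‖ := by
  have hρ : 0 < ρ := Metric.pos_of_mem_ball hwb
  obtain ⟨h, hd, hne, hle, heq⟩ := remove_zeros c w ρ hρ (Metric.ball_subset_closedBall hwb) _
    F hF hw hs rfl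
  have hharm : InnerProductSpace.HarmonicOnNhd (fun z => Real.log ‖h z‖) (Metric.closedBall c ρ) :=
    fun z hz => (hd.analyticAt z).harmonicAt_log_norm (hne z hz)
  have hP := hharm.circleAverage_poissonKernel_smul hwb
  have hcont : ContinuousOn (fun z => Real.log ‖h z‖) (Metric.sphere c ρ) := by
    apply ContinuousOn.log
    · exact hd.continuous.norm.continuousOn
    · intro z hz
      exact norm_ne_zero_iff.2 (hne z (Metric.sphere_subset_closedBall hz))
  have hpk : ContinuousOn (poissonKernel c w) (Metric.sphere c ρ) := by
    rw [poissonKernel_eq_re_herglotzRieszKernel]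
    have := continuousOn_herglotzRieszKernel_sphere hwb
    rw [abs_of_pos hρ] at this
    exact Complex.continuous_re.comp_continuousOn this
  have e1 : Real.circleAverage (fun z => - Real.log ‖F z‖) c ρ
      = Real.circleAverage (fun z => - Real.log ‖h z‖) c ρ := by
    apply Real.circleAverage_congr_sphere
    intro z hz
    rw [abs_of_pos hρ] at hz
    simp only [heq z hz]
  have e2 : Real.circleAverage (poissonKernel c w • fun z => Real.log ‖h z‖) c ρ
     ≤ Real.circleAverage (fun z => ((ρ - ‖w - c‖) / (ρ + ‖w - c‖)) • Real.log ‖h z‖) c ρ := by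
    apply Real.circleAverage_mono
    · exact (hpk.smul hcont).circleIntegrable hρ.le
    · exact (hcont.const_smul ((ρ - ‖w - c‖) / (ρ + ‖w - c‖))).circleIntegrable hρ.le
    · intro z hz
      rw [abs_of_pos hρ] at hz
      have hk := le_re_herglotzRieszKernel hz hwb
      have : Real.log ‖h z‖ ≤ 0 := by
        rw [heq z hz]
        exact Real.log_nonpos (norm_nonneg _) (h1 z hz)
      have e : poissonKernel c w z = ((z - c + (w - c)) / ((z - c) - (w - c))).re := by
        rw [poissonKernel_eq_re_herglotzRieszKernel]; rfl
      simp only [Pi.smul_apply', smul_eq_mul]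
      rw [e]
      exact mul_le_mul_of_nonpos_right hk this
  rw [hP, Real.circleAverage_fun_smul, smul_eq_mul] at e2
  have e3 : Real.circleAverage (fun z => - Real.log ‖h z‖) c ρ
      = - Real.circleAverage (fun z => Real.log ‖h z‖) c ρ := by
    have := Real.circleAverage_fun_smul (a := (-1:ℝ)) (f := fun z => Real.log ‖h z‖) (c := c) (R := ρ)
    simpa using this
  rw [e1, e3]
  have e4 : Real.log ‖F w‖ ≤ Real.log ‖h w‖ :=
    Real.log_le_log (norm_pos_iff.2 hw) (hle w (Metric.ball_subset_closedBall hwb))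
  linarith

lemma two_functions (F G : ℂ → ℂ) (hF : Differentiable ℂ F) (hG : Differentiable ℂ G)
    (hF1 : ∀ z : ℂ, 0 ≤ z.re → ‖F z‖ ≤ 1) (hG1 : ∀ z : ℂ, 0 ≤ z.re → ‖G z‖ ≤ 1)
    (C δ : ℝ) (hC : 0 < C) (hδ : 0 < δ)
    (hFG : ∀ z : ℂ, 0 ≤ z.re → ‖F z‖ * ‖G z‖ ≤ C * Real.exp (-δ * z.re)) :
    ∃ ε > 0, (∀ x : ℝ, 0 < x → ‖F x‖ ≤ Real.exp (-ε * x)) ∨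
      (∀ x : ℝ, 0 < x → ‖G x‖ ≤ Real.exp (-ε * x)) := by
  refine ⟨δ / 16, by positivity, ?_⟩
  by_contra! hcon
  obtain ⟨⟨x, hx, hFx⟩, y, hy, hGy⟩ := hcon
  set R : ℝ := x + y + 1 + 2 * |Real.log C| / δ with hR
  have hq : 0 ≤ 2 * |Real.log C| / δ := by positivity
  have hFx0 : F x ≠ 0 := norm_pos_iff.1 ((Real.exp_pos _).trans hFx)
  have hGy0 : G y ≠ 0 := norm_pos_iff.1 ((Real.exp_pos _).trans hGy)
  -- choose a radius without zeros
  obtain ⟨p, ⟨hp0, hpm⟩, hp⟩ : ∃ p ∈ Set.Ioo 0 (min x y / 2),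
      p ∉ ((fun z : ℂ => R - ‖z - R‖) '' ({z | z ∈ Metric.closedBall (R:ℂ) R ∧ F z = 0} ∪
        {z | z ∈ Metric.closedBall (R:ℂ) R ∧ G z = 0})) := by
    apply Set.Infinite.exists_notMem_finite
    · exact Set.Ioo_infinite (by positivity)
    · exact ((zeros_finite F hF _ hFx0 _ _).union (zeros_finite G hG _ hGy0 _ _)).image _
  have hpx : p < x / 2 := hpm.trans_le (by gcongr; exact min_le_left _ _)
  have hpy : p < y / 2 := hpm.trans_le (by gcongr; exact min_le_right _ _)
  set ρ := R - p with hρd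
  have hρ : 0 < ρ := by simp only [ρ, R]; linarith
  have hsub : ∀ z ∈ Metric.sphere (R:ℂ) ρ, 0 ≤ z.re := by
    intro z hz
    rw [mem_sphere_iff_norm] at hz
    have := (Complex.abs_re_le_norm (z - R)).trans_eq hz
    rw [abs_le] at this
    simp at this
    linarith [this.1]
  have hnz : ∀ z ∈ Metric.sphere (R:ℂ) ρ, F z ≠ 0 ∧ G z ≠ 0 := by
    intro z hz
    rw [mem_sphere_iff_norm] at hz
    have hzc : z ∈ Metric.closedBall (R:ℂ) R := by
      rw [mem_closedBall_iff_norm, hz]; simp only [ρ]; linarith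
    constructor
    · intro h
      exact hp ⟨z, Or.inl ⟨hzc, h⟩, by simp only [hz, ρ]; ring⟩
    · intro h
      exact hp ⟨z, Or.inr ⟨hzc, h⟩, by simp only [hz, ρ]; ring⟩
  have key : ∀ (H : ℂ → ℂ) (t : ℝ), Differentiable ℂ H → (∀ z : ℂ, 0 ≤ z.re → ‖H z‖ ≤ 1) →
      0 < t → t < R → p < t / 2 → Real.exp (-(δ/16) * t) < ‖H t‖ →
      (∀ z ∈ Metric.sphere (R:ℂ) ρ, H z ≠ 0) →
      Real.circleAverage (fun z => - Real.log ‖H z‖) R ρ ≤ δ / 4 * R := by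
    intro H t hH hH1 ht htR hpt hHt hHn
    have hHt0 : H t ≠ 0 := norm_pos_iff.1 ((Real.exp_pos _).trans hHt)
    have hn : ‖(t:ℂ) - R‖ = R - t := by
      rw [← Complex.ofReal_sub, Complex.norm_real, Real.norm_eq_abs, abs_sub_comm, abs_of_pos (by linarith)]
    have h := harnack R t ρ (by rw [mem_ball_iff_norm, hn]; simp only [ρ]; linarith) H hH hHt0 hHn
      (fun z hz => hH1 z (hsub z hz))
    have hlog : -(δ/16) * t < Real.log ‖H t‖ := by
      rw [Real.lt_log_iff_exp_lt (norm_pos_iff.2 hHt0)]; exact hHt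
    rw [hn] at h
    have hav : 0 ≤ Real.circleAverage (fun z => - Real.log ‖H z‖) R ρ := by
      apply Real.circleAverage_nonneg_of_nonneg
      intro z hz
      rw [abs_of_pos hρ] at hz
      have := Real.log_nonpos (norm_nonneg _) (hH1 z (hsub z hz))
      simpa using this
    set A := Real.circleAverage (fun z => - Real.log ‖H z‖) R ρ
    have hk : t / (4 * R) ≤ (ρ - (R - t)) / (ρ + (R - t)) := by
      simp only [ρ]
      rw [div_le_div_iff₀ (by linarith) (by linarith)]
      nlinarith
    have h3 : t / (4 * R) * A ≤ δ / 16 * t := by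
      have := mul_le_mul_of_nonneg_right hk hav
      linarith
    have hR0 : 0 < R := by linarith
    have h4 : t / (4 * R) * A = t * (A / (4 * R)) := by ring
    rw [h4, mul_comm (δ/16)] at h3
    have h5 := le_of_mul_le_mul_left h3 ht
    rw [div_le_iff₀ (by linarith)] at h5
    linarith
  have kF := key F x hF hF1 hx (by linarith) hpx hFx (fun z hz => (hnz z hz).1)
  have kG := key G y hG hG1 hy (by linarith) hpy hGy (fun z hz => (hnz z hz).2)
  have cF : CircleIntegrable (fun z => - Real.log ‖F z‖) R ρ := by
    apply ContinuousOn.circleIntegrable hρ.le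
    exact (hF.continuous.norm.continuousOn.log fun z hz => norm_ne_zero_iff.2 (hnz z hz).1).neg
  have cG : CircleIntegrable (fun z => - Real.log ‖G z‖) R ρ := by
    apply ContinuousOn.circleIntegrable hρ.le
    exact (hG.continuous.norm.continuousOn.log fun z hz => norm_ne_zero_iff.2 (hnz z hz).2).neg
  have hsum := Real.circleAverage_fun_add cF cG
  have hid : Real.circleAverage (fun z : ℂ => (δ * z - Real.log C : ℂ)) R ρ
      = δ * R - Real.log C := by
    have hd : DiffContOnCl ℂ (fun z : ℂ => (δ * z - Real.log C : ℂ)) (Metric.ball R |ρ|) := by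
      apply Differentiable.diffContOnCl
      fun_prop
    have := hd.circleAverage
    simpa using this
  have hid2 : Real.circleAverage (fun z : ℂ => δ * z.re - Real.log C) R ρ
      = δ * R - Real.log C := by
    have := Complex.reCLM.circleAverage_comp_comm (f := (fun z : ℂ => (δ * z - Real.log C : ℂ))) (c := R) (R := ρ)
       (by apply ContinuousOn.circleIntegrable hρ.le; fun_prop)
    rw [hid] at this
    simpa [Function.comp_def, ← Complex.ofReal_log hC.le] using this
  have hmono : Real.circleAverage (fun z : ℂ => δ * z.re - Real.log C) R ρ ≤
     Real.circleAverage (fun z => - Real.log ‖F z‖ + - Real.log ‖G z‖) R ρ := by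
    apply Real.circleAverage_mono
    · apply ContinuousOn.circleIntegrable hρ.le; fun_prop
    · exact cF.add cG
    · intro z hz
      rw [abs_of_pos hρ] at hz
      have h := hFG z (hsub z hz)
      have hF0 := norm_pos_iff.2 (hnz z hz).1
      have hG0 := norm_pos_iff.2 (hnz z hz).2
      have h2 := Real.log_le_log (mul_pos hF0 hG0) h
      rw [Real.log_mul hF0.ne' hG0.ne', Real.log_mul hC.ne' (Real.exp_pos _).ne', Real.log_exp] at h2
      linarith
  have hfin : δ * R - Real.log C ≤ δ / 2 * R := by
    rw [hid2] at hmono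
    linarith
  have : δ * (2 * |Real.log C| / δ) = 2 * |Real.log C| := by field_simp
  have h7 : δ * R = δ * (x + y + 1) + 2 * |Real.log C| := by rw [hR, mul_add, this]
  have h8 : 0 < δ * (x + y + 1) := by positivity
  linarith [le_abs_self (Real.log C)]

open FourierTransform in
lemma ae_zero_of_fourier (f : ℝ → ℂ) (hf : Integrable f) (h : ∀ w, 𝓕 f w = 0) :
    ∀ᵐ x, f x = 0 := by
  apply ae_eq_zero_of_integral_contDiff_smul_eq_zero hf.locallyIntegrable
  intro g g_smooth g_cpt
  have hg₁ : HasCompactSupport (Complex.ofRealCLM ∘ g) := g_cpt.comp_left rfl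
  have hg₂ : ContDiff ℝ (⊤ : ℕ∞) (Complex.ofRealCLM ∘ g) := by fun_prop
  let φ : SchwartzMap ℝ ℂ := hg₁.toSchwartzMap hg₂
  let η : SchwartzMap ℝ ℂ := 𝓕⁻ φ
  have hη : 𝓕 (η : ℝ → ℂ) = φ := by
    rw [← SchwartzMap.fourier_coe]
    simp [η]
  have := VectorFourier.integral_fourierIntegral_smul_eq_flip (μ := volume) (ν := volume)
    (L := innerₗ ℝ) (f := η) (g := f) Real.continuous_fourierChar continuous_inner η.integrable hf
  have e2 : VectorFourier.fourierIntegral Real.fourierChar volume (innerₗ ℝ).flip f = 0 := by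
    rw [flip_innerₗ ℝ]
    funext w
    exact h w
  rw [e2] at this
  have e1 : VectorFourier.fourierIntegral Real.fourierChar volume (innerₗ ℝ) (η : ℝ → ℂ) = φ := hη
  rw [e1] at this
  simpa [φ] using this

/-- Laplace transform. -/
noncomputable def lap (f : ℝ → ℂ) (z : ℂ) : ℂ := ∫ t : ℝ, f t * Complex.exp (-z * t)

lemma lap_norm_exp (z : ℂ) (t : ℝ) : ‖Complex.exp (-z * t)‖ = Real.exp (-z.re * t) := by
  rw [Complex.norm_exp]; simp

lemma lap_integrable (f : ℝ → ℂ) (hf : Integrable f) (S : ℝ)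
    (hS : ∀ t, t ∉ Set.Icc 0 S → f t = 0) (z : ℂ) :
    Integrable (fun t : ℝ => f t * Complex.exp (-z * t)) := by
  refine Integrable.mono' (g := fun t => ‖f t‖ * Real.exp (‖z‖ * |S|)) (hf.norm.mul_const _) ?_ ?_
  · exact hf.aestronglyMeasurable.mul (by fun_prop)
  · filter_upwards with t
    by_cases ht : t ∈ Set.Icc 0 S
    · rw [norm_mul, lap_norm_exp]
      have h1 : -z.re ≤ ‖z‖ := (neg_le_abs _).trans (Complex.abs_re_le_norm z)
      refine mul_le_mul_of_nonneg_left (Real.exp_le_exp.2 ?_) (norm_nonneg _)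
      calc -z.re * t ≤ ‖z‖ * t := mul_le_mul_of_nonneg_right h1 ht.1
        _ ≤ ‖z‖ * |S| := by gcongr; exact ht.2.trans (le_abs_self _)
    · simp [hS t ht]

lemma lap_diff (f : ℝ → ℂ) (hf : Integrable f) (S : ℝ)
    (hS : ∀ t, t ∉ Set.Icc 0 S → f t = 0) : Differentiable ℂ (lap f) := by
  intro z₀
  have := hasDerivAt_integral_of_dominated_loc_of_deriv_le (μ := (volume : Measure ℝ)) (x₀ := z₀)
    (F := fun z t => f t * Complex.exp (-z * t))
    (F' := fun z t => f t * (Complex.exp (-z * t) * (-t)))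
    (s := Metric.ball z₀ 1)
    (bound := fun t => ‖f t‖ * (Real.exp ((‖z₀‖ + 1) * |S|) * |S|)) (Metric.ball_mem_nhds _ one_pos)
    ?_ ?_ ?_ ?_ ?_ ?_
  · exact this.2.differentiableAt
  · filter_upwards with z
    exact (lap_integrable f hf S hS z).aestronglyMeasurable
  · exact lap_integrable f hf S hS z₀
  · exact hf.aestronglyMeasurable.mul (by fun_prop)
  · filter_upwards with t z hz
    by_cases ht : t ∈ Set.Icc 0 S
    · have hz' : ‖z‖ ≤ ‖z₀‖ + 1 := by
        rw [mem_ball_iff_norm] at hz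
        have := norm_sub_norm_le z z₀
        linarith
      have h1 : -z.re ≤ ‖z‖ := (neg_le_abs _).trans (Complex.abs_re_le_norm z)
      have h2 : |t| ≤ |S| := by
        rw [abs_of_nonneg ht.1]; exact ht.2.trans (le_abs_self _)
      rw [norm_mul, norm_mul, lap_norm_exp, norm_neg, Complex.norm_real, Real.norm_eq_abs]
      refine mul_le_mul_of_nonneg_left (mul_le_mul (Real.exp_le_exp.2 ?_) h2 (abs_nonneg _)
        (Real.exp_pos _).le) (norm_nonneg _)
      calc -z.re * t ≤ (‖z₀‖ + 1) * t := mul_le_mul_of_nonneg_right (h1.trans hz') ht.1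
        _ ≤ (‖z₀‖ + 1) * |S| := by gcongr; exact ht.2.trans (le_abs_self _)
    · simp [hS t ht]
  · exact hf.norm.mul_const _
  · filter_upwards with t z hz
    have h1 : HasDerivAt (fun z : ℂ => -z * t) (-(t:ℂ)) z := by
      simpa using ((hasDerivAt_id z).neg.mul_const (t:ℂ))
    exact (h1.cexp).const_mul (f t)

/-- bound with shift: if `f` vanishes a.e. below `a`, -/
lemma lap_bound (f : ℝ → ℂ) (hf : Integrable f) (a : ℝ)
    (ha : ∀ᵐ t, t < a → f t = 0) (z : ℂ) (hz : 0 ≤ z.re) :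
    ‖lap f z‖ ≤ Real.exp (-a * z.re) * ∫ t, ‖f t‖ := by
  rw [lap, ← integral_const_mul]
  apply norm_integral_le_of_norm_le (hf.norm.const_mul _)
  filter_upwards [ha] with t ht
  by_cases h : t < a
  · simp [ht h]
  · rw [norm_mul, lap_norm_exp, mul_comm]
    refine mul_le_mul_of_nonneg_right (Real.exp_le_exp.2 ?_) (norm_nonneg _)
    nlinarith

open FourierTransform in
lemma lap_fourier (f : ℝ → ℂ) (w : ℝ) : 𝓕 f w = lap f (2 * Real.pi * w * Complex.I) := by
  rw [Real.fourier_real_eq_integral_exp_smul, lap]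
  congr 1
  ext t
  rw [smul_eq_mul, mul_comm]
  congr 2
  push_cast
  ring

lemma lap_vanish (f : ℝ → ℂ) (hf : Integrable f) (S : ℝ)
    (hS : ∀ t, t ∉ Set.Icc 0 S → f t = 0) (a C : ℝ)
    (hC : ∀ x : ℝ, 0 < x → ‖lap f x‖ ≤ C * Real.exp (-a * x)) :
    ∀ᵐ t, t < a → f t = 0 := by
  rcases le_or_gt a 0 with ha | ha
  · filter_upwards with t ht
    exact hS t (fun h => by linarith [h.1])
  let f₁ : ℝ → ℂ := (Set.Iio a).indicator f
  let f₂ : ℝ → ℂ := (Set.Iio a)ᶜ.indicator f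
  have hf₁ : Integrable f₁ := hf.indicator measurableSet_Iio
  have hf₂ : Integrable f₂ := hf.indicator measurableSet_Iio.compl
  have hS₁ : ∀ t, t ∉ Set.Icc 0 S → f₁ t = 0 := fun t ht => by
    simp only [f₁, Set.indicator_apply, hS t ht, ite_self]
  have hS₂ : ∀ t, t ∉ Set.Icc 0 S → f₂ t = 0 := fun t ht => by
    simp only [f₂, Set.indicator_apply, hS t ht, ite_self]
  have hsum : ∀ z, lap f z = lap f₁ z + lap f₂ z := by
    intro z
    rw [lap, lap, lap, ← integral_add (lap_integrable f₁ hf₁ S hS₁ z) (lap_integrable f₂ hf₂ S hS₂ z)]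
    congr 1
    ext t
    rw [← add_mul]
    congr 1
    exact (congrFun (Set.indicator_self_add_compl (Set.Iio a) f) t).symm
  set N := ∫ t, ‖f₁ t‖
  have hN : 0 ≤ N := integral_nonneg fun _ => norm_nonneg _
  let h : ℂ → ℂ := fun z => Complex.exp (a * z) * lap f₁ z
  have hh : Differentiable ℂ h := by
    have := lap_diff f₁ hf₁ S hS₁
    simp only [h]
    fun_prop
  have hexp : ∀ z : ℂ, ‖Complex.exp (a * z)‖ = Real.exp (a * z.re) := by
    intro z; rw [Complex.norm_exp]; simp
  have hleft : ∀ z : ℂ, z.re ≤ 0 → ‖h z‖ ≤ N := by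
    intro z hz
    simp only [h, lap]
    rw [← integral_const_mul]
    apply norm_integral_le_of_norm_le hf₁.norm
    filter_upwards with t
    by_cases ht : t < a
    · rw [norm_mul, norm_mul, lap_norm_exp, hexp]
      have : Real.exp (a * z.re) * Real.exp (-z.re * t) ≤ 1 := by
        rw [← Real.exp_add]
        apply Real.exp_le_one_iff.2
        nlinarith
      calc _ = ‖f₁ t‖ * (Real.exp (a * z.re) * Real.exp (-z.re * t)) := by ring
        _ ≤ ‖f₁ t‖ * 1 := by gcongr
        _ = _ := mul_one _
    · simp [f₁, ht]
  have hpos₁ : ∀ᵐ t, t < 0 → f₁ t = 0 := by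
    filter_upwards with t ht
    exact hS₁ t (fun h => by linarith [h.1])
  have hpos₂ : ∀ᵐ t, t < a → f₂ t = 0 := by
    filter_upwards with t ht
    simp [f₂, ht]
  have hright : ∀ z : ℂ, 0 ≤ z.re → ‖h z‖ ≤ N := by
    intro z hz
    apply PhragmenLindelof.right_half_plane_of_bounded_on_real hh.diffContOnCl _ _ _ hz
    · refine ⟨1, by norm_num, a, ?_⟩
      apply Asymptotics.IsBigO.of_bound N
      rw [Filter.eventually_inf_principal]
      filter_upwards with z hz
      have hz : 0 < z.re := hz
      have := lap_bound f₁ hf₁ 0 hpos₁ z hz.le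
      simp only [neg_zero, zero_mul, Real.exp_zero, one_mul] at this
      rw [norm_mul, hexp, Real.rpow_one, Real.norm_of_nonneg (Real.exp_pos _).le, mul_comm]
      gcongr
      exact Complex.re_le_norm z
    · refine Filter.isBoundedUnder_of_eventually_le (a := C + ∫ t, ‖f₂ t‖) ?_
      filter_upwards [Filter.eventually_gt_atTop 0] with x hx
      have h1 := hC x hx
      have h2 := lap_bound f₂ hf₂ a hpos₂ x (by simpa using hx.le)
      have h3 : lap f₁ x = lap f x - lap f₂ x := by rw [hsum]; ring
      simp only [h]
      rw [norm_mul, hexp, h3]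
      simp only [Complex.ofReal_re] at h2 ⊢
      have h4 : Real.exp (a * x) * Real.exp (-a * x) = 1 := by
        rw [← Real.exp_add]; simp
      calc _ ≤ Real.exp (a * x) * (‖lap f x‖ + ‖lap f₂ x‖) := by gcongr; exact norm_sub_le _ _
        _ ≤ Real.exp (a * x) * (C * Real.exp (-a * x) + Real.exp (-a * x) * ∫ t, ‖f₂ t‖) := by
            gcongr
        _ = (Real.exp (a * x) * Real.exp (-a * x)) * (C + ∫ t, ‖f₂ t‖) := by ring
        _ = _ := by rw [h4, one_mul]
    · intro x
      exact hleft _ (by simp)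
  have hbdd : Bornology.IsBounded (Set.range h) := by
    rw [isBounded_iff_forall_norm_le]
    refine ⟨N, ?_⟩
    rintro _ ⟨z, rfl⟩
    rcases le_total z.re 0 with hz | hz
    · exact hleft z hz
    · exact hright z hz
  have hconst : ∀ z, h z = h 0 := fun z => hh.apply_eq_apply_of_bounded hbdd z 0
  have hFn : ∀ w : ℝ, ‖(FourierTransform.fourier f₁ : ℝ → ℂ) w‖ = ‖h 0‖ := by
    intro w
    rw [← hconst (2 * Real.pi * w * Complex.I), lap_fourier]
    simp only [h]
    rw [norm_mul, hexp]
    simp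
  have hK : ‖h 0‖ = 0 := by
    have h1 := (Real.zero_at_infty_fourier f₁).norm
    rw [norm_zero] at h1
    have h2 : Filter.Tendsto (fun w => ‖(FourierTransform.fourier f₁ : ℝ → ℂ) w‖)
      (Filter.cocompact ℝ) (nhds ‖h 0‖) := by
      simp only [hFn]
      exact tendsto_const_nhds
    exact tendsto_nhds_unique h2 h1
  have hz := ae_zero_of_fourier f₁ hf₁ (fun w => norm_eq_zero.1 ((hFn w).trans hK))
  filter_upwards [hz] with t ht hta
  simpa [f₁, hta] using ht

lemma lap_conv (f g : ℝ → ℂ) (hf : Integrable f) (hg : Integrable g) (S : ℝ)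
    (hfS : ∀ t, t ∉ Set.Icc 0 S → f t = 0) (hgS : ∀ t, t ∉ Set.Icc 0 S → g t = 0) (z : ℂ) :
    lap (fun x => ∫ y : ℝ, f y * g (x - y)) z = lap f z * lap g z := by
  have h := integral_convolution (μ := (volume : Measure ℝ)) (ν := (volume : Measure ℝ))
    (ContinuousLinearMap.mul ℂ ℂ) (lap_integrable f hf S hfS z) (lap_integrable g hg S hgS z)
  simp only [ContinuousLinearMap.mul_apply'] at h
  rw [lap, lap, lap, ← h]
  congr 1
  ext x
  simp only [convolution_def, ContinuousLinearMap.mul_apply']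
  rw [← integral_mul_const]
  congr 1
  ext y
  have : Complex.exp (-z * x) = Complex.exp (-z * y) * Complex.exp (-z * (x - y : ℝ)) := by
    rw [← Complex.exp_add]; congr 1; push_cast; ring
  rw [this]
  ring

lemma sup_attained (h : ℝ → ℂ) (T : ℝ) (hT : 0 ≤ T) (h0 : ∀ t < 0, h t = 0) :
    ∃ α, 0 ≤ α ∧ α ≤ T ∧ (∀ᵐ t, t < α → h t = 0) ∧
      ∀ a, 0 ≤ a → a ≤ T → (∀ᵐ t, t < a → h t = 0) → a ≤ α := by
  let A : Set ℝ := {a | 0 ≤ a ∧ a ≤ T ∧ ∀ᵐ t, t < a → h t = 0}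
  have hne : (0:ℝ) ∈ A := ⟨le_rfl, hT, by filter_upwards with t ht using h0 t ht⟩
  have hb : BddAbove A := ⟨T, fun a ha => ha.2.1⟩
  refine ⟨sSup A, le_csSup hb hne, csSup_le ⟨0, hne⟩ fun a ha => ha.2.1, ?_,
    fun a h1 h2 h3 => le_csSup hb ⟨h1, h2, h3⟩⟩
  obtain ⟨u, -, hu, huA⟩ := exists_seq_tendsto_sSup ⟨0, hne⟩ hb
  have : ∀ᵐ t, ∀ n, t < u n → h t = 0 := ae_all_iff.2 fun n => (huA n).2.2
  filter_upwards [this] with t ht hlt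
  obtain ⟨n, hn⟩ := (hu.eventually (lt_mem_nhds hlt)).exists
  exact ht n hn

lemma core (f g : ℝ → ℂ) (hf : Integrable f) (hg : Integrable g) (S : ℝ)
    (hfS : ∀ t, t ∉ Set.Icc 0 S → f t = 0) (hgS : ∀ t, t ∉ Set.Icc 0 S → g t = 0)
    (T α β : ℝ) (hlt : α + β < T)
    (hα : ∀ᵐ t, t < α → f t = 0) (hβ : ∀ᵐ t, t < β → g t = 0)
    (hc : ∀ᵐ x, x < T → (∫ y : ℝ, f y * g (x - y)) = 0) :
    ∃ ε > 0, (∀ᵐ t, t < α + ε → f t = 0) ∨ (∀ᵐ t, t < β + ε → g t = 0) := by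
  set M := ∫ t, ‖f t‖ with hM
  set N := ∫ t, ‖g t‖ with hN
  have hM0 : 0 ≤ M := integral_nonneg fun _ => norm_nonneg _
  have hN0 : 0 ≤ N := integral_nonneg fun _ => norm_nonneg _
  set c : ℝ → ℂ := fun x => ∫ y : ℝ, f y * g (x - y) with hcd
  have hci : Integrable c := hf.integrable_convolution (ContinuousLinearMap.mul ℂ ℂ) hg
  set K := ∫ t, ‖c t‖ with hK
  have hK0 : 0 ≤ K := integral_nonneg fun _ => norm_nonneg _
  have hexp : ∀ (a : ℝ) (z : ℂ), ‖Complex.exp (a * z)‖ = Real.exp (a * z.re) := by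
    intro a z; rw [Complex.norm_exp]; simp
  have hinv : ∀ a x : ℝ, Real.exp (a * x) * Real.exp (-a * x) = 1 := by
    intro a x; rw [← Real.exp_add]; simp
  have hM1 : ‖((M + 1 : ℝ) : ℂ)‖ = M + 1 := by
    rw [Complex.norm_real, Real.norm_of_nonneg (by linarith)]
  have hN1 : ‖((N + 1 : ℝ) : ℂ)‖ = N + 1 := by
    rw [Complex.norm_real, Real.norm_of_nonneg (by linarith)]
  let F : ℂ → ℂ := fun z => Complex.exp (α * z) * lap f z / ((M + 1 : ℝ) : ℂ)
  let G : ℂ → ℂ := fun z => Complex.exp (β * z) * lap g z / ((N + 1 : ℝ) : ℂ)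
  have nF : ∀ z, ‖F z‖ = Real.exp (α * z.re) * ‖lap f z‖ / (M + 1) := by
    intro z; simp only [F]; rw [norm_div, norm_mul, hexp, hM1]
  have nG : ∀ z, ‖G z‖ = Real.exp (β * z.re) * ‖lap g z‖ / (N + 1) := by
    intro z; simp only [G]; rw [norm_div, norm_mul, hexp, hN1]
  have dF : Differentiable ℂ F := by
    have := lap_diff f hf S hfS
    simp only [F]; fun_prop
  have dG : Differentiable ℂ G := by
    have := lap_diff g hg S hgS
    simp only [G]; fun_prop
  have key := two_functions F G dF dG ?_ ?_ (K + 1) (T - α - β) (by linarith)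
    (by linarith) ?_
  · obtain ⟨ε, hε, h⟩ := key
    refine ⟨ε, hε, ?_⟩
    rcases h with h | h
    · left
      apply lap_vanish f hf S hfS (α + ε) (M + 1)
      intro x hx
      have h1 := h x hx
      rw [nF, div_le_iff₀ (by linarith), Complex.ofReal_re] at h1
      calc ‖lap f x‖ = Real.exp (-α * x) * (Real.exp (α * x) * ‖lap f x‖) := by
            rw [← mul_assoc, mul_comm (Real.exp (-α * x)), hinv, one_mul]
        _ ≤ Real.exp (-α * x) * (Real.exp (-ε * x) * (M + 1)) := by gcongr
        _ = (M + 1) * (Real.exp (-α * x) * Real.exp (-ε * x)) := by ring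
        _ = _ := by rw [← Real.exp_add]; congr 2; ring
    · right
      apply lap_vanish g hg S hgS (β + ε) (N + 1)
      intro x hx
      have h1 := h x hx
      rw [nG, div_le_iff₀ (by linarith), Complex.ofReal_re] at h1
      calc ‖lap g x‖ = Real.exp (-β * x) * (Real.exp (β * x) * ‖lap g x‖) := by
            rw [← mul_assoc, mul_comm (Real.exp (-β * x)), hinv, one_mul]
        _ ≤ Real.exp (-β * x) * (Real.exp (-ε * x) * (N + 1)) := by gcongr
        _ = (N + 1) * (Real.exp (-β * x) * Real.exp (-ε * x)) := by ring
        _ = _ := by rw [← Real.exp_add]; congr 2; ring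
  · intro z hz
    have hb := lap_bound f hf α hα z hz
    rw [nF, div_le_one (by linarith)]
    calc _ ≤ Real.exp (α * z.re) * (Real.exp (-α * z.re) * M) := by gcongr
      _ = M := by rw [← mul_assoc, hinv, one_mul]
      _ ≤ M + 1 := by linarith
  · intro z hz
    have hb := lap_bound g hg β hβ z hz
    rw [nG, div_le_one (by linarith)]
    calc _ ≤ Real.exp (β * z.re) * (Real.exp (-β * z.re) * N) := by gcongr
      _ = N := by rw [← mul_assoc, hinv, one_mul]
      _ ≤ N + 1 := by linarith
  · intro z hz
    have hb := lap_bound c hci T hc z hz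
    rw [lap_conv f g hf hg S hfS hgS z, norm_mul] at hb
    have e1 : ‖F z‖ ≤ Real.exp (α * z.re) * ‖lap f z‖ := by
      rw [nF]; exact div_le_self (by positivity) (by linarith)
    have e2 : ‖G z‖ ≤ Real.exp (β * z.re) * ‖lap g z‖ := by
      rw [nG]; exact div_le_self (by positivity) (by linarith)
    calc ‖F z‖ * ‖G z‖ ≤ (Real.exp (α * z.re) * ‖lap f z‖) * (Real.exp (β * z.re) * ‖lap g z‖) := by
          gcongr
      _ = (Real.exp (α * z.re) * Real.exp (β * z.re)) * (‖lap f z‖ * ‖lap g z‖) := by ring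
      _ ≤ (Real.exp (α * z.re) * Real.exp (β * z.re)) * (Real.exp (-T * z.re) * K) := by gcongr
      _ = K * (Real.exp (α * z.re) * Real.exp (β * z.re) * Real.exp (-T * z.re)) := by ring
      _ = K * Real.exp (-(T - α - β) * z.re) := by
          rw [← Real.exp_add, ← Real.exp_add]; congr 2; ring
      _ ≤ _ := by gcongr; linarith

end Titch


/-- **Titchmarsh convolution theorem.** If `f, g ∈ L¹(ℝ)` vanish on `(-∞, 0)` and
`f * g` vanishes a.e. on `(-∞, T]`, then there are `α, β ≥ 0` with `α + β = T` such that
`f` vanishes a.e. on `[0, α]` and `g` vanishes a.e. on `[0, β]`. -/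
theorem titchmarsh_convolution (f g : ℝ → ℂ) (hf : Integrable f) (hg : Integrable g)
    (hf0 : ∀ x < (0 : ℝ), f x = 0) (hg0 : ∀ x < (0 : ℝ), g x = 0)
    (T : ℝ) (hT : 0 ≤ T)
    (hconv : ∀ᵐ x ∂(volume.restrict (Set.Iic T)), (∫ y : ℝ, f y * g (x - y)) = 0) :
    ∃ α β : ℝ, 0 ≤ α ∧ 0 ≤ β ∧ α + β = T ∧
      (∀ᵐ x ∂(volume.restrict (Set.Icc (0 : ℝ) α)), f x = 0) ∧
      (∀ᵐ x ∂(volume.restrict (Set.Icc (0 : ℝ) β)), g x = 0) := by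

  let f' : ℝ → ℂ := (Set.Iic T).indicator f
  let g' : ℝ → ℂ := (Set.Iic T).indicator g
  have hf' : Integrable f' := hf.indicator measurableSet_Iic
  have hg' : Integrable g' := hg.indicator measurableSet_Iic
  have supp : ∀ h : ℝ → ℂ, (∀ x < (0:ℝ), h x = 0) →
      ∀ t, t ∉ Set.Icc 0 T → (Set.Iic T).indicator h t = 0 := by
    intro h h0 t ht
    by_cases h1 : t ≤ T
    · have : t < 0 := by
        by_contra h2
        exact ht ⟨not_lt.1 h2, h1⟩
      simp [Set.indicator_apply, h0 t this]
    · simp [Set.indicator_apply, h1]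
  have hfS : ∀ t, t ∉ Set.Icc 0 T → f' t = 0 := supp f hf0
  have hgS : ∀ t, t ∉ Set.Icc 0 T → g' t = 0 := supp g hg0
  have hc : ∀ᵐ x, x < T → (∫ y : ℝ, f' y * g' (x - y)) = 0 := by
    rw [ae_restrict_iff' measurableSet_Iic] at hconv
    filter_upwards [hconv] with x hx hxT
    rw [← hx hxT.le]
    congr 1
    ext y
    rcases lt_or_ge y 0 with hy | hy
    · simp [f', Set.indicator_apply, hf0 y hy]
    · have h2 : x - y ≤ T := by linarith
      by_cases h1 : y ≤ T
      · simp only [f', g', Set.indicator_apply, Set.mem_Iic, h1, h2, if_true]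
      · have h3 : x - y < 0 := by linarith
        simp [g', Set.indicator_apply, hg0 _ h3]
  obtain ⟨α, hα0, hαT, hα, hαmax⟩ := Titch.sup_attained f' T hT
    (fun t ht => hfS t fun h => by linarith [h.1])
  obtain ⟨β, hβ0, hβT, hβ, hβmax⟩ := Titch.sup_attained g' T hT
    (fun t ht => hgS t fun h => by linarith [h.1])
  have hsum : T ≤ α + β := by
    by_contra! hlt
    obtain ⟨ε, hε, h | h⟩ := Titch.core f' g' hf' hg' T hfS hgS T α β hlt hα hβ hc
    · have := hαmax (min (α + ε) T) (le_min (by linarith) hT) (min_le_right _ _)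
        (by filter_upwards [h] with t ht htl using ht (htl.trans_le (min_le_left _ _)))
      rcases min_le_iff.1 this with h | h <;> linarith
    · have := hβmax (min (β + ε) T) (le_min (by linarith) hT) (min_le_right _ _)
        (by filter_upwards [h] with t ht htl using ht (htl.trans_le (min_le_left _ _)))
      rcases min_le_iff.1 this with h | h <;> linarith
  have fin : ∀ (h : ℝ → ℂ) (a b : ℝ), b ≤ T → b ≤ a →
      (∀ᵐ t, t < a → (Set.Iic T).indicator h t = 0) →
      ∀ᵐ x ∂(volume.restrict (Set.Icc (0 : ℝ) b)), h x = 0 := by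
    intro h a b hb hba hh
    rw [ae_restrict_iff' measurableSet_Icc]
    have hne : ∀ᵐ t : ℝ, t ≠ b := Measure.ae_ne volume b
    filter_upwards [hh, hne] with t ht htb hmem
    have h1 := ht ((lt_of_le_of_ne hmem.2 htb).trans_le hba)
    have h2 : t ≤ T := hmem.2.trans hb
    simpa [Set.indicator_apply, h2] using h1
  exact ⟨α, T - α, hα0, by linarith, by ring, fin f α α hαT le_rfl hα,
    fin g β (T - α) (by linarith) (by linarith) hβ⟩
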